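/- arXiv:1808.08856 — 4 statements merged into one kernel-verified Lean document; each statement's English description precedes it below -/
import Mathlib

section
/- Let (Ω, 𝓕, μ) be a probability space with a filtration (𝓕_j)_{j∈ℕ}, and let (ξ_j)_{j≥1} be real random variables such that each ξ_j is 𝓕_j-measurable, |ξ_j| ≤ M almost surely for a constant M ≥ 0, and E[ξ_j | 𝓕_{j−1}] = ρ almost surely for every j ≥ 1, where ρ ∈ ℝ is a deterministic constant. Then for every integer m ≥ 1 there exists a constant C depending only on m and M such that E[(∑_{j=1}^N ξ_j)^{4m}] ≤ C · (N^{2m} + N^{4m} ρ^{4m}) for all N ≥ 1. -/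
open MeasureTheory

theorem Real.pow_le_factorial_mul_exp_add_exp_neg {n : ℕ} (hn : Even n) (x : ℝ) :
    x ^ n ≤ n.factorial * (Real.exp x + Real.exp (-x)) := by
  have h := Real.pow_div_factorial_le_exp |x| (abs_nonneg x) n
  rw [div_le_iff₀ (by positivity), hn.pow_abs, mul_comm] at h
  exact h.trans (by gcongr; exact Real.exp_abs_le x)

theorem ae_abs_sum_range_le {Ω : Type*} {m0 : MeasurableSpace Ω} {μ : Measure Ω}
    {d : ℕ → Ω → ℝ} {δ : ℝ} (hd : ∀ i, ∀ᵐ ω ∂μ, |d i ω| ≤ δ) (k : ℕ) :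
    ∀ᵐ ω ∂μ, |∑ i ∈ Finset.range k, d i ω| ≤ k * δ := by
  filter_upwards [ae_all_iff.2 hd] with ω hω
  calc |∑ i ∈ Finset.range k, d i ω| ≤ ∑ i ∈ Finset.range k, |d i ω| :=
        Finset.abs_sum_le_sum_abs _ _
    _ ≤ ∑ _i ∈ Finset.range k, δ := Finset.sum_le_sum fun i _ => hω i
    _ = k * δ := by simp

theorem stronglyMeasurable_sum_range_of_filtration {Ω : Type*} {m0 : MeasurableSpace Ω}
    {𝓕 : Filtration ℕ m0} {d : ℕ → Ω → ℝ}
    (hm : ∀ i, StronglyMeasurable[𝓕 (i + 1)] (d i)) (k : ℕ) :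
    StronglyMeasurable[𝓕 k] fun ω => ∑ i ∈ Finset.range k, d i ω :=
  Finset.stronglyMeasurable_fun_sum _ fun i hi =>
    (hm i).mono (𝓕.mono (Finset.mem_range.1 hi))

theorem integrable_exp_sum_range {Ω : Type*} {m0 : MeasurableSpace Ω} {μ : Measure Ω}
    [IsFiniteMeasure μ] {𝓕 : Filtration ℕ m0} {d : ℕ → Ω → ℝ} {δ : ℝ}
    (hm : ∀ i, StronglyMeasurable[𝓕 (i + 1)] (d i))
    (hd : ∀ i, ∀ᵐ ω ∂μ, |d i ω| ≤ δ) (k : ℕ) :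
    Integrable (fun ω => Real.exp (∑ i ∈ Finset.range k, d i ω)) μ := by
  refine Integrable.of_bound (C := Real.exp (k * δ)) (Real.continuous_exp.comp_stronglyMeasurable
    ((stronglyMeasurable_sum_range_of_filtration hm k).mono (𝓕.le k))).aestronglyMeasurable ?_
  filter_upwards [ae_abs_sum_range_le hd k] with ω hω
  rw [Real.norm_eq_abs, Real.abs_exp]
  exact Real.exp_le_exp.2 ((le_abs_self _).trans hω)

/-- Exponential moment bound for a sum of martingale differences bounded by `δ ≤ 1`. -/
theorem integral_exp_sum_range_le {Ω : Type*} {m0 : MeasurableSpace Ω} {μ : Measure Ω}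
    [IsProbabilityMeasure μ] {𝓕 : Filtration ℕ m0} {d : ℕ → Ω → ℝ} {δ : ℝ} (hδ : δ ≤ 1)
    (hm : ∀ i, StronglyMeasurable[𝓕 (i + 1)] (d i))
    (hd : ∀ i, ∀ᵐ ω ∂μ, |d i ω| ≤ δ) (hc : ∀ i, μ[d i | 𝓕 i] =ᵐ[μ] 0) (k : ℕ) :
    ∫ ω, Real.exp (∑ i ∈ Finset.range k, d i ω) ∂μ ≤ (1 + δ ^ 2) ^ k := by
  induction k with
  | zero => simp
  | succ k ih =>
    set f : Ω → ℝ := fun ω => Real.exp (∑ i ∈ Finset.range k, d i ω) with hf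
    have hfi : Integrable f μ := integrable_exp_sum_range hm hd k
    have hfm : StronglyMeasurable[𝓕 k] f := Real.continuous_exp.comp_stronglyMeasurable
      (stronglyMeasurable_sum_range_of_filtration hm k)
    have hdm : AEStronglyMeasurable (d k) μ :=
      ((hm k).mono (𝓕.le (k + 1))).aestronglyMeasurable
    have hdi : Integrable (d k) μ := Integrable.of_bound hdm δ (hd k)
    have hfd : Integrable (f * d k) μ := hfi.mul_bdd hdm (hd k)
    have hzero : ∫ ω, f ω * d k ω ∂μ = 0 := by
      have h := condExp_mul_of_stronglyMeasurable_left hfm hfd hdi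
      calc ∫ ω, f ω * d k ω ∂μ = ∫ ω, (μ[f * d k | 𝓕 k]) ω ∂μ :=
            (integral_condExp (𝓕.le k)).symm
        _ = ∫ _ω, (0 : ℝ) ∂μ := by
            refine integral_congr_ae ?_
            filter_upwards [h, hc k] with ω h1 h2
            simp [h1, h2]
        _ = 0 := by simp
    calc ∫ ω, Real.exp (∑ i ∈ Finset.range (k + 1), d i ω) ∂μ
        ≤ ∫ ω, ((1 + δ ^ 2) * f ω + f ω * d k ω) ∂μ := by
          refine integral_mono_ae (integrable_exp_sum_range hm hd (k + 1))
            ((hfi.const_mul _).add hfd) ?_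
          filter_upwards [hd k] with ω hω
          have h1 := (abs_le.1 (Real.abs_exp_sub_one_sub_id_le (hω.trans hδ))).2
          have h2 : d k ω ^ 2 ≤ δ ^ 2 := sq_le_sq' (abs_le.1 hω).1 (abs_le.1 hω).2
          simp only [Finset.sum_range_succ, Real.exp_add]
          have h3 : Real.exp (d k ω) ≤ 1 + δ ^ 2 + d k ω := by linarith
          have h4 := mul_le_mul_of_nonneg_left h3 (Real.exp_pos (∑ i ∈ Finset.range k, d i ω)).le
          simp only [hf]
          linarith
      _ = (1 + δ ^ 2) * ∫ ω, f ω ∂μ := by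
          have hfd' : Integrable (fun ω => f ω * d k ω) μ := hfd
          rw [integral_add (hfi.const_mul _) hfd', integral_const_mul, hzero, add_zero]
      _ ≤ (1 + δ ^ 2) ^ (k + 1) := by
          rw [pow_succ' _ k]
          exact mul_le_mul_of_nonneg_left ih (by positivity)

/-- Even moment bound for a sum of `N` martingale differences bounded by `K`. -/
theorem integral_sum_range_pow_le {Ω : Type*} {m0 : MeasurableSpace Ω} {μ : Measure Ω}
    [IsProbabilityMeasure μ] {𝓕 : Filtration ℕ m0} {d : ℕ → Ω → ℝ} {K : ℝ} (hK : 0 < K)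
    (hm : ∀ i, StronglyMeasurable[𝓕 (i + 1)] (d i))
    (hd : ∀ i, ∀ᵐ ω ∂μ, |d i ω| ≤ K) (hc : ∀ i, μ[d i | 𝓕 i] =ᵐ[μ] 0)
    (p : ℕ) {N : ℕ} (hN : 1 ≤ N) :
    ∫ ω, (∑ i ∈ Finset.range N, d i ω) ^ (2 * p) ∂μ
      ≤ K ^ (2 * p) * N ^ p * ((2 * p).factorial * (2 * Real.exp 1)) := by
  have hN' : (1 : ℝ) ≤ N := by exact_mod_cast hN
  have hs : 1 ≤ √(N : ℝ) := Real.one_le_sqrt.2 hN'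
  have hs2 : √(N : ℝ) ^ 2 = N := Real.sq_sqrt (by positivity)
  have hδ : (√(N : ℝ))⁻¹ ≤ 1 := inv_le_one_of_one_le₀ hs
  have key : ∀ t : ℝ, |t| = (K * √N)⁻¹ →
      Integrable (fun ω => Real.exp (t * ∑ i ∈ Finset.range N, d i ω)) μ ∧
      ∫ ω, Real.exp (t * ∑ i ∈ Finset.range N, d i ω) ∂μ ≤ Real.exp 1 := by
    intro t ht
    have hm' : ∀ i, StronglyMeasurable[𝓕 (i + 1)] (fun ω => t * d i ω) :=
      fun i => (hm i).const_mul t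
    have hd' : ∀ i, ∀ᵐ ω ∂μ, |t * d i ω| ≤ (√(N : ℝ))⁻¹ := by
      intro i
      filter_upwards [hd i] with ω hω
      calc |t * d i ω| = (K * √N)⁻¹ * |d i ω| := by rw [abs_mul, ht]
        _ ≤ (K * √N)⁻¹ * K := by gcongr
        _ = (√(N : ℝ))⁻¹ := by field_simp
    have hc' : ∀ i, μ[fun ω => t * d i ω | 𝓕 i] =ᵐ[μ] 0 := by
      intro i
      filter_upwards [condExp_smul (μ := μ) t (d i) (𝓕 i), hc i] with ω h1 h2
      refine h1.trans ?_
      simp [h2]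
    simp only [Finset.mul_sum]
    refine ⟨integrable_exp_sum_range hm' hd' N,
      (integral_exp_sum_range_le hδ hm' hd' hc' N).trans ?_⟩
    calc (1 + (√(N : ℝ))⁻¹ ^ 2) ^ N ≤ Real.exp ((N : ℝ)⁻¹) ^ N := by
          rw [inv_pow, hs2]
          gcongr
          linarith [Real.add_one_le_exp ((N : ℝ)⁻¹)]
      _ = Real.exp 1 := by
          rw [← Real.exp_nat_mul, mul_inv_cancel₀ (by positivity)]
  set t : ℝ := (K * √N)⁻¹ with ht
  have htpos : 0 < t := by positivity
  obtain ⟨hi1, hb1⟩ := key t (abs_of_pos htpos)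
  obtain ⟨hi2, hb2⟩ := key (-t) (by rw [abs_neg, abs_of_pos htpos])
  have htp : t ^ (2 * p) * (K ^ (2 * p) * N ^ p) = 1 := by
    rw [ht, inv_pow, mul_pow, pow_mul (√(N : ℝ)), hs2]
    field_simp
  set S : Ω → ℝ := fun ω => ∑ i ∈ Finset.range N, d i ω
  have hpt : ∀ ω, S ω ^ (2 * p) ≤ K ^ (2 * p) * N ^ p *
      ((2 * p).factorial * (Real.exp (t * S ω) + Real.exp (-t * S ω))) := by
    intro ω
    have h := Real.pow_le_factorial_mul_exp_add_exp_neg (even_two_mul p) (t * S ω)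
    calc S ω ^ (2 * p) = K ^ (2 * p) * N ^ p * (t * S ω) ^ (2 * p) := by
          rw [mul_pow]; linear_combination (-S ω ^ (2 * p)) * htp
      _ ≤ _ := by rw [neg_mul]; gcongr
  calc ∫ ω, S ω ^ (2 * p) ∂μ
      ≤ ∫ ω, K ^ (2 * p) * N ^ p *
        ((2 * p).factorial * (Real.exp (t * S ω) + Real.exp (-t * S ω))) ∂μ :=
        integral_mono_of_nonneg (ae_of_all _ fun ω => (even_two_mul p).pow_nonneg _)
          (((hi1.add hi2).const_mul _).const_mul _) (ae_of_all _ hpt)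
    _ = K ^ (2 * p) * N ^ p * ((2 * p).factorial *
        (∫ ω, Real.exp (t * S ω) ∂μ + ∫ ω, Real.exp (-t * S ω) ∂μ)) := by
        rw [integral_const_mul, integral_const_mul, integral_add hi1 hi2]
    _ ≤ _ := by
        gcongr
        linarith

/-- Moment bound for bounded sequences with constant conditional drift `ρ`:
for every integer `m ≥ 1` and `M ≥ 0` there is a constant `C` depending only on `m` and
`M` such that for every probability space, filtration `𝓕`, and sequence `ξ` with `ξ_j`
`𝓕_j`-measurable, `|ξ_j| ≤ M` a.s. and `E[ξ_j | 𝓕_{j−1}] = ρ` a.s., one has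
`E[(∑_{j=1}^N ξ_j)^{4m}] ≤ C (N^{2m} + N^{4m} ρ^{4m})` for all `N ≥ 1`. -/
theorem drifted_martingale_moment_bound (m : ℕ) (hm : 1 ≤ m) (M : ℝ) (hM : 0 ≤ M) :
    ∃ C : ℝ, ∀ (Ω : Type) [m0 : MeasurableSpace Ω] (μ : Measure Ω),
      IsProbabilityMeasure μ →
      ∀ (𝓕 : Filtration ℕ m0) (ξ : ℕ → Ω → ℝ) (ρ : ℝ),
        (∀ j, 1 ≤ j → StronglyMeasurable[𝓕 j] (ξ j)) →
        (∀ j, 1 ≤ j → ∀ᵐ ω ∂μ, |ξ j ω| ≤ M) →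
        (∀ j, 1 ≤ j → μ[ξ j | 𝓕 (j - 1)] =ᵐ[μ] fun _ => ρ) →
        ∀ N : ℕ, 1 ≤ N →
          ∫ ω, (∑ j ∈ Finset.Icc 1 N, ξ j ω) ^ (4 * m) ∂μ
            ≤ C * ((N : ℝ) ^ (2 * m) + (N : ℝ) ^ (4 * m) * ρ ^ (4 * m)) := by
  refine ⟨2 ^ (4 * m - 1) * ((2 * M + 1) ^ (4 * m) *
    ((4 * m).factorial * (2 * Real.exp 1)) + 1), ?_⟩
  intro Ω m0 μ hμ 𝓕 ξ ρ hmeas hbd hcond N hN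
  have hξi : ∀ i, Integrable (ξ (i + 1)) μ := fun i =>
    Integrable.of_bound ((hmeas (i + 1) (by omega)).mono (𝓕.le _)).aestronglyMeasurable M
      (hbd (i + 1) (by omega))
  have hρ : |ρ| ≤ M := by
    have h1 : ∫ ω, ξ 1 ω ∂μ = ρ := by
      rw [← integral_condExp (𝓕.le (1 - 1)), integral_congr_ae (hcond 1 le_rfl)]
      simp
    have h2 := norm_integral_le_of_norm_le_const (μ := μ) (f := ξ 1) (hbd 1 le_rfl)
    simpa [h1] using h2
  set d : ℕ → Ω → ℝ := fun i ω => ξ (i + 1) ω - ρ with hd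
  have hdm : ∀ i, StronglyMeasurable[𝓕 (i + 1)] (d i) := fun i =>
    (hmeas (i + 1) (by omega)).sub stronglyMeasurable_const
  have hdb : ∀ i, ∀ᵐ ω ∂μ, |d i ω| ≤ 2 * M + 1 := by
    intro i
    filter_upwards [hbd (i + 1) (by omega)] with ω hω
    have := abs_sub (ξ (i + 1) ω) ρ
    simp only [hd]
    linarith
  have hdc : ∀ i, μ[d i | 𝓕 i] =ᵐ[μ] 0 := by
    intro i
    have h1 := condExp_sub (hξi i) (integrable_const (μ := μ) ρ) (𝓕 i)
    rw [condExp_const (𝓕.le i)] at h1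
    filter_upwards [h1, hcond (i + 1) (by omega)] with ω h2 h3
    refine h2.trans ?_
    simp only [Nat.add_sub_cancel] at h3
    simp [h3]
  have hmom := integral_sum_range_pow_le (by positivity) hdm hdb hdc (2 * m) hN
  rw [show 2 * (2 * m) = 4 * m by ring] at hmom
  have heven : Even (4 * m) := ⟨2 * m, by ring⟩
  have hsum : ∀ ω, ∑ j ∈ Finset.Icc 1 N, ξ j ω = ∑ i ∈ Finset.range N, d i ω + N * ρ := by
    intro ω
    rw [← Finset.Ico_add_one_right_eq_Icc, Finset.sum_Ico_eq_sum_range]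
    simp [hd, add_comm]
  have hint : Integrable (fun ω => (∑ i ∈ Finset.range N, d i ω) ^ (4 * m)) μ := by
    refine Integrable.of_bound (C := (N * (2 * M + 1)) ^ (4 * m))
      ((((stronglyMeasurable_sum_range_of_filtration hdm N).mono
        (𝓕.le N)).pow _).aestronglyMeasurable) ?_
    filter_upwards [ae_abs_sum_range_le hdb N] with ω hω
    rw [norm_pow, Real.norm_eq_abs]
    gcongr
  have hNρ : 0 ≤ (N : ℝ) ^ (4 * m) * ρ ^ (4 * m) :=
    mul_nonneg (by positivity) (heven.pow_nonneg ρ)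
  calc ∫ ω, (∑ j ∈ Finset.Icc 1 N, ξ j ω) ^ (4 * m) ∂μ
      ≤ ∫ ω, 2 ^ (4 * m - 1) *
        ((∑ i ∈ Finset.range N, d i ω) ^ (4 * m) + (N * ρ) ^ (4 * m)) ∂μ := by
        refine integral_mono_of_nonneg (ae_of_all _ fun ω => heven.pow_nonneg _)
          ((hint.add (integrable_const _)).const_mul _) (ae_of_all _ fun ω => ?_)
        simp only [hsum]
        exact heven.add_pow_le
    _ = 2 ^ (4 * m - 1) *
        (∫ ω, (∑ i ∈ Finset.range N, d i ω) ^ (4 * m) ∂μ + (N : ℝ) ^ (4 * m) * ρ ^ (4 * m)) := by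
        rw [integral_const_mul, integral_add hint (integrable_const _), integral_const, mul_pow]
        simp
    _ ≤ _ := by
        rw [mul_assoc]
        gcongr
        have h1 : 0 ≤ (N : ℝ) ^ (2 * m) := by positivity
        have h2 : 0 ≤ (2 * M + 1) ^ (4 * m) * ((4 * m).factorial * (2 * Real.exp 1)) *
            ((N : ℝ) ^ (4 * m) * ρ ^ (4 * m)) := by positivity
        linarith
end

section
/- Let (Ω, 𝓕, μ) be a probability space with a filtration (𝓕_j)_{j∈ℕ}, and let (X_j)_{j≥1} and (Y_j)_{j≥1} be real random variables such that X_j and Y_j are 𝓕_j-measurable, |X_j| ≤ M and |Y_j| ≤ M almost surely for a constant M ≥ 0, and E[X_j | 𝓕_{j−1}] = 0 and E[Y_j | 𝓕_{j−1}] = 0 almost surely for all j ≥ 1. Then for every integer m ≥ 1 there exists a constant C depending only on m such that E[(∑_{j₂=2}^{N} Y_{j₂} · (∑_{j₁=1}^{j₂−1} X_{j₁}))^{2m}] ≤ C · M^{4m} · N^{2m} for all N ≥ 2. -/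
open MeasureTheory

/-- Second-order Taylor remainder bound for a power. -/
lemma abs_add_pow_sub_le (s d : ℝ) (q : ℕ) :
    |(s + d) ^ (q + 2) - s ^ (q + 2) - (q + 2) * s ^ (q + 1) * d|
      ≤ (q + 2) ^ 2 * (d ^ 2 * (|s| + |d|) ^ q) := by
  induction q with
  | zero =>
    have h : (s + d) ^ (0 + 2) - s ^ (0 + 2) - ((0 : ℕ) + 2) * s ^ (0 + 1) * d = d ^ 2 := by
      push_cast; ring
    rw [h, abs_of_nonneg (sq_nonneg d)]
    norm_num
    nlinarith [sq_nonneg d]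
  | succ q ih =>
    have h : (s + d) ^ (q + 1 + 2) - s ^ (q + 1 + 2)
          - ((q + 1 : ℕ) + 2) * s ^ (q + 1 + 1) * d
        = (s + d) * ((s + d) ^ (q + 2) - s ^ (q + 2) - (q + 2) * s ^ (q + 1) * d)
          + (q + 2) * s ^ (q + 1) * d ^ 2 := by
      push_cast; ring
    have hs : |s| ^ (q + 1) ≤ (|s| + |d|) ^ (q + 1) := by
      gcongr; linarith [abs_nonneg d]
    have hp : 0 ≤ d ^ 2 * (|s| + |d|) ^ (q + 1) := by positivity
    rw [h]
    calc _ ≤ |s + d| * |(s + d) ^ (q + 2) - s ^ (q + 2) - (q + 2) * s ^ (q + 1) * d|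
          + (q + 2) * |s| ^ (q + 1) * d ^ 2 := by
          refine (abs_add_le _ _).trans_eq ?_
          rw [abs_mul, abs_mul, abs_mul, abs_pow, abs_of_nonneg (sq_nonneg d),
            abs_of_nonneg (by positivity : (0 : ℝ) ≤ q + 2)]
      _ ≤ (|s| + |d|) * ((q + 2) ^ 2 * (d ^ 2 * (|s| + |d|) ^ q))
          + (q + 2) * (|s| + |d|) ^ (q + 1) * d ^ 2 := by
          gcongr
          exact abs_add_le s d
      _ = ((q + 2) ^ 2 + (q + 2)) * (d ^ 2 * (|s| + |d|) ^ (q + 1)) := by ring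
      _ ≤ _ := by
          refine mul_le_mul_of_nonneg_right ?_ hp
          push_cast
          nlinarith [(Nat.cast_nonneg q : (0 : ℝ) ≤ q)]

/-- A weighted Young-type inequality, by comparing `s ^ 2` with `n * d ^ 2`. -/
lemma sq_mul_abs_add_abs_pow_le (s d : ℝ) {n : ℝ} (hn : 1 ≤ n) (k : ℕ) :
    d ^ 2 * (|s| + |d|) ^ (2 * k)
      ≤ 4 ^ k * (s ^ (2 * (k + 1)) / n + n ^ k * d ^ (2 * (k + 1))) := by
  have hn0 : 0 < n := by linarith
  have hsq : (|s| + |d|) ^ 2 ≤ 2 * (s ^ 2 + d ^ 2) := by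
    nlinarith [sq_nonneg (|s| - |d|), sq_abs s, sq_abs d]
  have hs : 0 ≤ s ^ (2 * (k + 1)) / n := by
    rw [pow_mul]; positivity
  have hd : 0 ≤ n ^ k * d ^ (2 * (k + 1)) := by
    rw [pow_mul d]; positivity
  rw [pow_mul (|s| + |d|)]
  rcases le_total (n * d ^ 2) (s ^ 2) with h | h
  · have h1 : d ^ 2 ≤ s ^ 2 / n := by
      rw [le_div_iff₀ hn0]; linarith
    have h2 : (|s| + |d|) ^ 2 ≤ 4 * s ^ 2 := by nlinarith [sq_nonneg d]
    calc d ^ 2 * ((|s| + |d|) ^ 2) ^ k ≤ s ^ 2 / n * (4 * s ^ 2) ^ k := by gcongr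
      _ = 4 ^ k * (s ^ (2 * (k + 1)) / n) := by
          rw [mul_pow, pow_mul s, pow_succ]; ring
      _ ≤ _ := by gcongr; linarith
  · have h2 : (|s| + |d|) ^ 2 ≤ 4 * (n * d ^ 2) := by nlinarith [sq_nonneg d]
    calc d ^ 2 * ((|s| + |d|) ^ 2) ^ k ≤ d ^ 2 * (4 * (n * d ^ 2)) ^ k := by gcongr
      _ = 4 ^ k * (n ^ k * d ^ (2 * (k + 1))) := by
          rw [mul_pow, mul_pow, pow_mul d, pow_succ]; ring
      _ ≤ _ := by gcongr; linarith

lemma add_pow_two_mul_le (s d : ℝ) {n : ℝ} (hn : 1 ≤ n) (k : ℕ) :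
    (s + d) ^ (2 * (k + 1)) ≤ s ^ (2 * (k + 1)) + (2 * k + 2) * (s ^ (2 * k + 1) * d)
      + (2 * k + 2) ^ 2 * 4 ^ k * (s ^ (2 * (k + 1)) / n + n ^ k * d ^ (2 * (k + 1))) := by
  have h1 := (le_abs_self _).trans (abs_add_pow_sub_le s d (2 * k))
  have h2 := mul_le_mul_of_nonneg_left (sq_mul_abs_add_abs_pow_le s d hn k)
    (by positivity : (0 : ℝ) ≤ (2 * k + 2) ^ 2)
  push_cast at h1
  rw [show 2 * (k + 1) = 2 * k + 2 by ring] at *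
  linarith

lemma le_of_affine_recursion {a : ℕ → ℝ} {r b : ℝ} {N : ℕ} (hr : 1 ≤ r) (hb : 0 ≤ b)
    (h0 : a 0 = 0) (h : ∀ n < N, a (n + 1) ≤ r * a n + b) :
    ∀ n ≤ N, a n ≤ r ^ n * (n * b) := by
  intro n
  induction n with
  | zero => simp [h0]
  | succ n ih =>
    intro hn
    have h1 := mul_le_mul_of_nonneg_left (ih (by omega)) (by linarith : 0 ≤ r)
    have h2 : b ≤ r ^ (n + 1) * b := le_mul_of_one_le_left hb (one_le_pow₀ hr)
    calc a (n + 1) ≤ r * a n + b := h n (by omega)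
      _ ≤ r * (r ^ n * (n * b)) + r ^ (n + 1) * b := by linarith
      _ = _ := by push_cast; ring

lemma MeasureTheory.MemLp.pow_top {Ω : Type*} [MeasurableSpace Ω] {μ : Measure Ω}
    [IsFiniteMeasure μ] {f : Ω → ℝ} (hf : MemLp f ⊤ μ) (n : ℕ) :
    MemLp (fun ω => f ω ^ n) ⊤ μ := by
  induction n with
  | zero => simpa using memLp_const (1 : ℝ)
  | succ n ih =>
    simp only [pow_succ]
    exact hf.mul ih

/-- A conditionally centred factor makes the product with any past variable centred. -/
lemma integral_mul_eq_zero_of_condExp_eq_zero {Ω : Type*} {m m0 : MeasurableSpace Ω}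
    {μ : Measure Ω} [IsFiniteMeasure μ] (hm : m ≤ m0) {f g : Ω → ℝ}
    (hf : StronglyMeasurable[m] f) (hfg : Integrable (fun ω => f ω * g ω) μ)
    (hg : Integrable g μ) (h : μ[g | m] =ᵐ[μ] 0) :
    ∫ ω, f ω * g ω ∂μ = 0 := by
  rw [← integral_condExp hm]
  refine integral_eq_zero_of_ae ?_
  filter_upwards [condExp_mul_of_stronglyMeasurable_left hf hfg hg, h] with ω h1 h2
  have h3 : (μ[fun ω => f ω * g ω | m]) ω = f ω * (μ[g | m]) ω := h1
  rw [h3, h2]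
  simp

/-- Moment bound of Burkholder type for sums of bounded martingale differences. -/
lemma integral_sum_pow_le_of_martingale_difference {Ω : Type*} [m0 : MeasurableSpace Ω]
    {μ : Measure Ω} [IsProbabilityMeasure μ] {𝓕 : Filtration ℕ m0} {d : ℕ → Ω → ℝ}
    (hmeas : ∀ j, 1 ≤ j → StronglyMeasurable[𝓕 j] (d j))
    (hbdd : ∀ j, 1 ≤ j → MemLp (d j) ⊤ μ)
    (hcond : ∀ j, 1 ≤ j → μ[d j | 𝓕 (j - 1)] =ᵐ[μ] 0) (k : ℕ) {N : ℕ} {D : ℝ}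
    (hD : 0 ≤ D) (hmom : ∀ j, 1 ≤ j → j ≤ N → ∫ ω, d j ω ^ (2 * (k + 1)) ∂μ ≤ D) :
    ∫ ω, (∑ j ∈ Finset.Icc 1 N, d j ω) ^ (2 * (k + 1)) ∂μ
      ≤ Real.exp ((2 * k + 2) ^ 2 * 4 ^ k) * ((2 * k + 2) ^ 2 * 4 ^ k)
        * (N : ℝ) ^ (k + 1) * D := by
  rcases Nat.eq_zero_or_pos N with rfl | hN
  · simp
  set c : ℝ := (2 * k + 2) ^ 2 * 4 ^ k
  have hc0 : 0 ≤ c := by positivity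
  have hN1 : (1 : ℝ) ≤ N := by exact_mod_cast hN
  let S : ℕ → Ω → ℝ := fun n ω => ∑ j ∈ Finset.Icc 1 n, d j ω
  have hS : ∀ n, MemLp (S n) ⊤ μ := fun n =>
    memLp_finsetSum _ fun j hj => hbdd j (Finset.mem_Icc.1 hj).1
  have hSm : ∀ n, StronglyMeasurable[𝓕 n] (S n) := fun n =>
    Finset.stronglyMeasurable_fun_sum _ fun j hj =>
      (hmeas j (Finset.mem_Icc.1 hj).1).mono (𝓕.mono (Finset.mem_Icc.1 hj).2)
  have hrec : ∀ n < N, ∫ ω, S (n + 1) ω ^ (2 * (k + 1)) ∂μ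
      ≤ (1 + c / N) * ∫ ω, S n ω ^ (2 * (k + 1)) ∂μ + c * ((N : ℝ) ^ k * D) := by
    intro n hn
    have hd := hbdd (n + 1) (by omega)
    have hI : Integrable (fun ω => S n ω ^ (2 * (k + 1))) μ :=
      ((hS n).pow_top _).integrable le_top
    have hId : Integrable (fun ω => d (n + 1) ω ^ (2 * (k + 1))) μ :=
      (hd.pow_top _).integrable le_top
    have hIm : Integrable (fun ω => S n ω ^ (2 * k + 1) * d (n + 1) ω) μ :=
      MemLp.integrable le_top (hd.mul ((hS n).pow_top (2 * k + 1)))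
    have hzero : ∫ ω, S n ω ^ (2 * k + 1) * d (n + 1) ω ∂μ = 0 :=
      integral_mul_eq_zero_of_condExp_eq_zero (𝓕.le n) ((hSm n).pow _) hIm
        (hd.integrable le_top) (hcond (n + 1) (by omega))
    have hlin : Integrable (fun ω => S n ω ^ (2 * (k + 1))
        + (2 * k + 2) * (S n ω ^ (2 * k + 1) * d (n + 1) ω)) μ := hI.add (hIm.const_mul _)
    have hrem : Integrable (fun ω => c * (S n ω ^ (2 * (k + 1)) / N
        + (N : ℝ) ^ k * d (n + 1) ω ^ (2 * (k + 1)))) μ :=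
      ((hI.div_const _).add (hId.const_mul _)).const_mul _
    calc ∫ ω, S (n + 1) ω ^ (2 * (k + 1)) ∂μ
        ≤ ∫ ω, (S n ω ^ (2 * (k + 1)) + (2 * k + 2) * (S n ω ^ (2 * k + 1) * d (n + 1) ω)
          + c * (S n ω ^ (2 * (k + 1)) / N
            + (N : ℝ) ^ k * d (n + 1) ω ^ (2 * (k + 1)))) ∂μ := by
          refine integral_mono (((hS (n + 1)).pow_top _).integrable le_top)
            (hlin.add hrem) fun ω => ?_
          have hsucc : S (n + 1) ω = S n ω + d (n + 1) ω :=
            Finset.sum_Icc_succ_top (by omega) _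
          simp only [hsucc]
          exact add_pow_two_mul_le _ _ hN1 k
      _ = (1 + c / N) * ∫ ω, S n ω ^ (2 * (k + 1)) ∂μ
          + c * ((N : ℝ) ^ k * ∫ ω, d (n + 1) ω ^ (2 * (k + 1)) ∂μ) := by
          rw [integral_add hlin hrem, integral_add hI (hIm.const_mul _), integral_const_mul, hzero, integral_const_mul,
            integral_add (hI.div_const _) (hId.const_mul _), integral_div, integral_const_mul]
          ring
      _ ≤ _ := by
          gcongr
          exact hmom (n + 1) (by omega) hn
  have hfin := le_of_affine_recursion (a := fun n => ∫ ω, S n ω ^ (2 * (k + 1)) ∂μ)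
    (le_add_of_nonneg_right (by positivity)) (by positivity) (by simp [S]) hrec N le_rfl
  have hexp : (1 + c / N) ^ N ≤ Real.exp c := by
    calc (1 + c / N) ^ N ≤ Real.exp (c / N) ^ N := by
          gcongr
          linarith [Real.add_one_le_exp (c / N)]
      _ = Real.exp c := by
          rw [← Real.exp_nat_mul]
          congr 1
          field_simp
  calc _ ≤ (1 + c / N) ^ N * (N * (c * ((N : ℝ) ^ k * D))) := hfin
    _ ≤ Real.exp c * (N * (c * ((N : ℝ) ^ k * D))) := by gcongr
    _ = _ := by ring

/-- Moment bound for the discrete stochastic (Lévy) area of two bounded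
martingale-difference sequences: for every integer `m ≥ 1` there is a constant `C`
depending only on `m` such that
`E[(∑_{j₂=2}^N Y_{j₂} (∑_{j₁=1}^{j₂−1} X_{j₁}))^{2m}] ≤ C · M^{4m} · N^{2m}` for all `N ≥ 2`. -/
theorem discrete_area_moment_bound (m : ℕ) (hm : 1 ≤ m) :
    ∃ C : ℝ, ∀ (Ω : Type) [m0 : MeasurableSpace Ω] (μ : Measure Ω),
      IsProbabilityMeasure μ →
      ∀ (𝓕 : Filtration ℕ m0) (X Y : ℕ → Ω → ℝ) (M : ℝ),
        0 ≤ M →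
        (∀ j, 1 ≤ j → StronglyMeasurable[𝓕 j] (X j)) →
        (∀ j, 1 ≤ j → StronglyMeasurable[𝓕 j] (Y j)) →
        (∀ j, 1 ≤ j → ∀ᵐ ω ∂μ, |X j ω| ≤ M) →
        (∀ j, 1 ≤ j → ∀ᵐ ω ∂μ, |Y j ω| ≤ M) →
        (∀ j, 1 ≤ j → μ[X j | 𝓕 (j - 1)] =ᵐ[μ] 0) →
        (∀ j, 1 ≤ j → μ[Y j | 𝓕 (j - 1)] =ᵐ[μ] 0) →
        ∀ N : ℕ, 2 ≤ N →
          ∫ ω, (∑ j₂ ∈ Finset.Icc 2 N, Y j₂ ω * ∑ j₁ ∈ Finset.Icc 1 (j₂ - 1), X j₁ ω) ^ (2 * m) ∂μ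
            ≤ C * M ^ (4 * m) * (N : ℝ) ^ (2 * m) := by
  obtain ⟨k, rfl⟩ : ∃ k, m = k + 1 := ⟨m - 1, by omega⟩
  let K : ℝ := Real.exp ((2 * k + 2) ^ 2 * 4 ^ k) * ((2 * k + 2) ^ 2 * 4 ^ k)
  have hK : 0 ≤ K := by positivity
  refine ⟨K ^ 2, ?_⟩
  intro Ω m0 μ _ 𝓕 X Y M hM hX hY hXM hYM hXc hYc N hN
  have memLp_of_bound : ∀ Z : ℕ → Ω → ℝ, (∀ j, 1 ≤ j → StronglyMeasurable[𝓕 j] (Z j)) →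
      (∀ j, 1 ≤ j → ∀ᵐ ω ∂μ, |Z j ω| ≤ M) → ∀ j, 1 ≤ j → MemLp (Z j) ⊤ μ :=
    fun Z hZ hZM j hj =>
      memLp_top_of_bound ((hZ j hj).mono (𝓕.le j)).aestronglyMeasurable M (hZM j hj)
  have hXL := memLp_of_bound X hX hXM
  have hYL := memLp_of_bound Y hY hYM
  have pow_le : ∀ x : ℝ, |x| ≤ M → x ^ (2 * (k + 1)) ≤ M ^ (2 * (k + 1)) := fun x hx => by
    rw [← (even_two_mul (k + 1)).pow_abs]
    gcongr
  let S : ℕ → Ω → ℝ := fun n ω => ∑ j ∈ Finset.Icc 1 n, X j ω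
  have hSL : ∀ n, MemLp (S n) ⊤ μ := fun n =>
    memLp_finsetSum _ fun j hj => hXL j (Finset.mem_Icc.1 hj).1
  have hSm : ∀ n, StronglyMeasurable[𝓕 n] (S n) := fun n =>
    Finset.stronglyMeasurable_fun_sum _ fun j hj =>
      (hX j (Finset.mem_Icc.1 hj).1).mono (𝓕.mono (Finset.mem_Icc.1 hj).2)
  have hXmom : ∀ j, 1 ≤ j → ∫ ω, X j ω ^ (2 * (k + 1)) ∂μ ≤ M ^ (2 * (k + 1)) := by
    intro j hj
    calc ∫ ω, X j ω ^ (2 * (k + 1)) ∂μ ≤ ∫ _, M ^ (2 * (k + 1)) ∂μ := by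
          refine integral_mono_ae (((hXL j hj).pow_top _).integrable le_top)
            (integrable_const _) ?_
          filter_upwards [hXM j hj] with ω hω using pow_le _ hω
      _ = _ := by simp
  have hSmom : ∀ n ≤ N, ∫ ω, S n ω ^ (2 * (k + 1)) ∂μ
      ≤ K * (N : ℝ) ^ (k + 1) * M ^ (2 * (k + 1)) := by
    intro n hn
    refine (integral_sum_pow_le_of_martingale_difference hX hXL hXc k (by positivity)
      fun j hj _ => hXmom j hj).trans ?_
    change K * (n : ℝ) ^ (k + 1) * M ^ (2 * (k + 1)) ≤ _
    gcongr
  have hdL : ∀ j, 1 ≤ j → MemLp (fun ω => S (j - 1) ω * Y j ω) ⊤ μ := fun j hj =>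
    (hYL j hj).mul (hSL (j - 1))
  have hdm : ∀ j, 1 ≤ j → StronglyMeasurable[𝓕 j] (fun ω => S (j - 1) ω * Y j ω) :=
    fun j hj => ((hSm (j - 1)).mono (𝓕.mono (Nat.sub_le j 1))).mul (hY j hj)
  have hdc : ∀ j, 1 ≤ j → μ[fun ω => S (j - 1) ω * Y j ω | 𝓕 (j - 1)] =ᵐ[μ] 0 := by
    intro j hj
    filter_upwards [condExp_mul_of_stronglyMeasurable_left (hSm (j - 1))
      ((hdL j hj).integrable le_top) ((hYL j hj).integrable le_top), hYc j hj] with ω h1 h2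
    have h3 : (μ[fun ω => S (j - 1) ω * Y j ω | 𝓕 (j - 1)]) ω
        = S (j - 1) ω * (μ[Y j | 𝓕 (j - 1)]) ω := h1
    rw [h3, h2]
    simp
  have hdmom : ∀ j, 1 ≤ j → j ≤ N → ∫ ω, (S (j - 1) ω * Y j ω) ^ (2 * (k + 1)) ∂μ
      ≤ K * (N : ℝ) ^ (k + 1) * M ^ (2 * (k + 1)) * M ^ (2 * (k + 1)) := by
    intro j hj hjN
    calc ∫ ω, (S (j - 1) ω * Y j ω) ^ (2 * (k + 1)) ∂μ
        ≤ ∫ ω, S (j - 1) ω ^ (2 * (k + 1)) * M ^ (2 * (k + 1)) ∂μ := by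
          refine integral_mono_ae (((hdL j hj).pow_top _).integrable le_top)
            ((((hSL (j - 1)).pow_top _).integrable le_top).mul_const _) ?_
          filter_upwards [hYM j hj] with ω hω
          rw [mul_pow]
          exact mul_le_mul_of_nonneg_left (pow_le _ hω) ((even_two_mul _).pow_nonneg _)
      _ ≤ _ := by
          rw [integral_mul_const]
          gcongr
          exact hSmom (j - 1) (by omega)
  have key := integral_sum_pow_le_of_martingale_difference hdm hdL hdc k (by positivity) hdmom
  have hsum : ∀ ω, ∑ j ∈ Finset.Icc 2 N, Y j ω * ∑ i ∈ Finset.Icc 1 (j - 1), X i ω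
      = ∑ j ∈ Finset.Icc 1 N, S (j - 1) ω * Y j ω := by
    intro ω
    rw [← Finset.add_sum_Ioc_eq_sum_Icc (show 1 ≤ N by omega)]
    simp only [S, mul_comm]
    simp
    rfl
  simp only [hsum]
  refine key.trans_eq ?_
  change K * (N : ℝ) ^ (k + 1) * (K * (N : ℝ) ^ (k + 1) * M ^ (2 * (k + 1)) * M ^ (2 * (k + 1)))
    = _
  ring
end

section
/- Let θ > 1 and K ≥ 0, and let Ξ assign to each pair 0 ≤ s ≤ t ≤ 1 a real number Ξ(s,t) such that |Ξ(s,t) − Ξ(s,u) − Ξ(u,t)| ≤ K (t−s)^θ whenever 0 ≤ s ≤ u ≤ t ≤ 1. Then for every 0 ≤ s ≤ t ≤ 1 and every partition Δ = {s = t₀ < t₁ < ⋯ < t_N = t} of [s,t], writing Ξ(Δ) := ∑_{i=0}^{N−1} Ξ(t_i, t_{i+1}), one has |Ξ(Δ) − Ξ(s,t)| ≤ 2^θ ζ(θ) K (t−s)^θ, where ζ(θ) = ∑_{n=1}^∞ n^{−θ}. -/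
/-- The Riemann zeta sum `ζ(θ) = ∑_{n=1}^∞ n^{−θ}`. -/
noncomputable def zetaSum (θ : ℝ) : ℝ := ∑' n : ℕ, 1 / ((n : ℝ) + 1) ^ θ

open Finset in
/-- A monotone finite sequence has two consecutive steps of total length at most twice the
average. -/
theorem Monotone.exists_two_steps_le {u : ℕ → ℝ} (hu : Monotone u) (M : ℕ) :
    ∃ j < M + 1, u (j + 2) - u j ≤ 2 * (u (M + 2) - u 0) / ((M : ℝ) + 1) := by
  have htel : ∑ j ∈ range (M + 1), (u (j + 2) - u j) ≤ 2 * (u (M + 2) - u 0) := by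
    have hsplit : ∑ j ∈ range (M + 1), (u (j + 2) - u j)
        = (u (M + 2) - u 1) + (u (M + 1) - u 0) := by
      have h1 := sum_range_sub (fun j => u (j + 1)) (M + 1)
      have h2 := sum_range_sub u (M + 1)
      rw [← h2, ← h1, ← sum_add_distrib]
      exact sum_congr rfl fun j _ => by ring
    have h1 : u 0 ≤ u 1 := hu (by omega)
    have h2 : u (M + 1) ≤ u (M + 2) := hu (by omega)
    linarith
  have hM : (0 : ℝ) < (M : ℝ) + 1 := by positivity
  obtain ⟨j, hj, hle⟩ := exists_le_of_sum_le (s := range (M + 1))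
    (f := fun j => u (j + 2) - u j)
    (g := fun _ => 2 * (u (M + 2) - u 0) / ((M : ℝ) + 1)) ⟨0, by simp⟩ (by
      rw [sum_const, card_range, nsmul_eq_mul]
      push_cast
      rwa [mul_div_cancel₀ _ hM.ne'])
  exact ⟨j, mem_range.1 hj, hle⟩

open Finset in
/-- Effect on a partition sum of removing the point with index `j + 1`. -/
theorem sum_range_remove_point (Ξ : ℝ → ℝ → ℝ) (u : ℕ → ℝ) {j M : ℕ} (hj : j < M + 1) :
    ∑ i ∈ range (M + 2), Ξ (u i) (u (i + 1))
      = ∑ i ∈ range (M + 1), Ξ (u (if i ≤ j then i else i + 1))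
          (u (if i + 1 ≤ j then i + 1 else i + 1 + 1))
        - (Ξ (u j) (u (j + 2)) - Ξ (u j) (u (j + 1)) - Ξ (u (j + 1)) (u (j + 2))) := by
  obtain ⟨k, rfl⟩ : ∃ k, M = j + k := ⟨M - j, by omega⟩
  rw [show j + k + 2 = j + 1 + 1 + k by ring, show j + k + 1 = j + 1 + k by ring,
    sum_range_add _ (j + 1 + 1) k, sum_range_add _ (j + 1) k]
  simp only [sum_range_succ _ j, sum_range_succ _ (j + 1)]
  have hlow : ∑ i ∈ range j, Ξ (u (if i ≤ j then i else i + 1))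
      (u (if i + 1 ≤ j then i + 1 else i + 1 + 1)) = ∑ i ∈ range j, Ξ (u i) (u (i + 1)) := by
    refine sum_congr rfl fun i hi => ?_
    have := mem_range.1 hi
    rw [if_pos (by omega), if_pos (by omega)]
  have hhigh : ∑ i ∈ range k, Ξ (u (if j + 1 + i ≤ j then j + 1 + i else j + 1 + i + 1))
      (u (if j + 1 + i + 1 ≤ j then j + 1 + i + 1 else j + 1 + i + 1 + 1))
      = ∑ i ∈ range k, Ξ (u (j + 1 + 1 + i)) (u (j + 1 + 1 + i + 1)) := by
    refine sum_congr rfl fun i _ => ?_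
    rw [if_neg (by omega), if_neg (by omega), show j + 1 + i + 1 = j + 1 + 1 + i by ring]
  rw [hlow, hhigh, if_pos le_rfl, if_neg (by omega)]
  ring

open Finset in
/-- Successive point removal for a monotone sequence, with the finite sum of errors. -/
theorem abs_partition_sum_sub_le {θ K : ℝ} (hθ : 0 ≤ θ) (hK : 0 ≤ K) {Ξ : ℝ → ℝ → ℝ} {a b : ℝ}
    (hnear : ∀ s u t : ℝ, a ≤ s → s ≤ u → u ≤ t → t ≤ b →
      |Ξ s t - Ξ s u - Ξ u t| ≤ K * (t - s) ^ θ) (M : ℕ) :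
    ∀ u : ℕ → ℝ, Monotone u → a ≤ u 0 → u (M + 1) ≤ b →
      |∑ i ∈ range (M + 1), Ξ (u i) (u (i + 1)) - Ξ (u 0) (u (M + 1))|
        ≤ ∑ n ∈ range M, K * (2 * (u (M + 1) - u 0) / ((n : ℝ) + 1)) ^ θ := by
  induction M with
  | zero => intro u _ _ _; simp
  | succ M ih =>
    intro u hu ha hb
    obtain ⟨j, hj, hle⟩ := hu.exists_two_steps_le M
    have hv : Monotone fun i => u (if i ≤ j then i else i + 1) := by
      refine hu.comp fun i k hik => ?_
      split_ifs <;> omega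
    have hlast : ¬ M + 1 ≤ j := by omega
    have hrec := ih _ hv (by simpa using ha) (by simpa only [if_neg hlast] using hb)
    simp only [if_neg hlast, if_pos (Nat.zero_le j)] at hrec
    have hstep := hnear (u j) (u (j + 1)) (u (j + 2)) (ha.trans (hu (Nat.zero_le j)))
      (hu (by omega)) (hu (by omega)) ((hu (by omega)).trans hb)
    have hpow : (u (j + 2) - u j) ^ θ ≤ (2 * (u (M + 2) - u 0) / ((M : ℝ) + 1)) ^ θ :=
      Real.rpow_le_rpow (sub_nonneg.2 (hu (by omega))) hle hθ
    rw [sum_range_remove_point Ξ u hj, sub_right_comm,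
      sum_range_succ (fun n : ℕ => K * (2 * (u (M + 1 + 1) - u 0) / ((n : ℝ) + 1)) ^ θ) M]
    exact (abs_sub _ _).trans
      (add_le_add hrec (hstep.trans (mul_le_mul_of_nonneg_left hpow hK)))

/-- The partial sums of the zeta series are bounded by its value. -/
theorem sum_range_le_zetaSum {θ : ℝ} (hθ : 1 < θ) (M : ℕ) :
    ∑ n ∈ Finset.range M, 1 / ((n : ℝ) + 1) ^ θ ≤ zetaSum θ := by
  have hsum : Summable fun n : ℕ => 1 / ((n : ℝ) + 1) ^ θ := by
    simpa using (summable_nat_add_iff 1).2 (Real.summable_one_div_nat_rpow.2 hθ)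
  exact hsum.sum_le_tsum _ fun n _ => by positivity

/-- point-removal estimate for a near-additive function: if
`|Ξ(s,t) − Ξ(s,u) − Ξ(u,t)| ≤ K (t−s)^θ` with `θ > 1`, then for every partition
`Δ = {s = t₀ < ⋯ < t_N = t}` of `[s,t]`, writing `Ξ(Δ) = ∑_i Ξ(t_i, t_{i+1})`, one has
`|Ξ(Δ) − Ξ(s,t)| ≤ 2^θ ζ(θ) K (t−s)^θ`. -/
theorem near_additive_partition_estimate (θ K : ℝ) (hθ : 1 < θ) (hK : 0 ≤ K)
    (Ξ : ℝ → ℝ → ℝ)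
    (hnear : ∀ s u t : ℝ, 0 ≤ s → s ≤ u → u ≤ t → t ≤ 1 →
      |Ξ s t - Ξ s u - Ξ u t| ≤ K * (t - s) ^ θ)
    (s t : ℝ) (hs : 0 ≤ s) (hst : s ≤ t) (ht : t ≤ 1)
    (N : ℕ) (hN : 1 ≤ N) (u : ℕ → ℝ)
    (hu0 : u 0 = s) (huN : u N = t)
    (hmono : ∀ i, i < N → u i < u (i + 1)) :
    |(∑ i ∈ Finset.range N, Ξ (u i) (u (i + 1))) - Ξ s t|
      ≤ 2 ^ θ * zetaSum θ * K * (t - s) ^ θ := by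
  obtain ⟨M, rfl⟩ : ∃ M, N = M + 1 := ⟨N - 1, by omega⟩
  have hw : Monotone fun i => u (min i (M + 1)) := by
    refine monotone_nat_of_le_succ fun i => ?_
    rcases lt_or_ge i (M + 1) with hi | hi
    · rw [min_eq_left hi.le, min_eq_left (Nat.succ_le_of_lt hi)]
      exact (hmono i hi).le
    · rw [min_eq_right hi, min_eq_right (by omega)]
  have hbound := abs_partition_sum_sub_le (by linarith) hK hnear M _ hw
    (by simpa [hu0] using hs) (by simpa [huN] using ht)
  have hsum : ∑ i ∈ Finset.range (M + 1), Ξ (u (min i (M + 1))) (u (min (i + 1) (M + 1)))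
      = ∑ i ∈ Finset.range (M + 1), Ξ (u i) (u (i + 1)) := by
    refine Finset.sum_congr rfl fun i hi => ?_
    have := Finset.mem_range.1 hi
    rw [min_eq_left (by omega), min_eq_left (by omega)]
  rw [hsum] at hbound
  simp only [min_self, Nat.zero_min, hu0, huN] at hbound
  have hts : 0 ≤ t - s := sub_nonneg.2 hst
  refine hbound.trans ?_
  calc ∑ n ∈ Finset.range M, K * (2 * (t - s) / ((n : ℝ) + 1)) ^ θ
      = 2 ^ θ * K * (t - s) ^ θ * ∑ n ∈ Finset.range M, 1 / ((n : ℝ) + 1) ^ θ := by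
        rw [Finset.mul_sum]
        refine Finset.sum_congr rfl fun n _ => ?_
        rw [Real.div_rpow (by positivity) (by positivity), Real.mul_rpow (by norm_num) hts]
        ring
    _ ≤ 2 ^ θ * K * (t - s) ^ θ * zetaSum θ :=
        mul_le_mul_of_nonneg_left (sum_range_le_zetaSum hθ M) (by positivity)
    _ = 2 ^ θ * zetaSum θ * K * (t - s) ^ θ := by ring
end

section
/- Let θ > 1 and K ≥ 0, and let Ξ assign to each pair 0 ≤ s ≤ t ≤ 1 a real number Ξ(s,t) with Ξ(t,t) = 0 and |Ξ(s,t) − Ξ(s,u) − Ξ(u,t)| ≤ K (t−s)^θ whenever 0 ≤ s ≤ u ≤ t ≤ 1. Then there exists a unique function I on pairs 0 ≤ s ≤ t ≤ 1 such that: (i) I is additive, i.e. I(s,t) = I(s,u) + I(u,t) for 0 ≤ s ≤ u ≤ t ≤ 1; (ii) |I(s,t) − Ξ(s,t)| ≤ 2^θ ζ(θ) K (t−s)^θ for all 0 ≤ s ≤ t ≤ 1; moreover, for every 0 ≤ s ≤ t ≤ 1 and every sequence of partitions Δ_n of [s,t] with mesh tending to 0, the sums Ξ(Δ_n) converge to I(s,t).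 -/
open Finset Filter Topology

lemma summable_one_div_nat_add_one_rpow {θ : ℝ} (hθ : 1 < θ) :
    Summable fun n : ℕ => 1 / ((n : ℝ) + 1) ^ θ := by
  have h := (summable_nat_add_iff 1).2 (Real.summable_one_div_nat_rpow.2 hθ)
  simpa using h

lemma zetaSum_nonneg (θ : ℝ) : 0 ≤ zetaSum θ :=
  tsum_nonneg fun n => by positivity

/-- Merging the two consecutive steps around the point `u (i + 1)` of a sequence changes its
partition sum by a single defect of additivity. -/
lemma sum_range_skip (Ξ : ℝ → ℝ → ℝ) (u : ℕ → ℝ) (i m : ℕ) :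
    ∑ j ∈ range (i + m + 2), Ξ (u j) (u (j + 1)) =
      ∑ j ∈ range (i + m + 1),
        Ξ (if j ≤ i then u j else u (j + 1)) (if j + 1 ≤ i then u (j + 1) else u (j + 1 + 1)) +
      (Ξ (u i) (u (i + 1)) + Ξ (u (i + 1)) (u (i + 2)) - Ξ (u i) (u (i + 2))) := by
  induction m with
  | zero =>
    have h : ∑ j ∈ range i,
        Ξ (if j ≤ i then u j else u (j + 1)) (if j + 1 ≤ i then u (j + 1) else u (j + 1 + 1)) =
        ∑ j ∈ range i, Ξ (u j) (u (j + 1)) := by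
      refine sum_congr rfl fun j hj => ?_
      have hj := mem_range.1 hj
      rw [if_pos (by omega), if_pos (by omega)]
    rw [add_zero, sum_range_succ, sum_range_succ, sum_range_succ, h, if_pos le_rfl,
      if_neg (by omega)]
    ring
  | succ m ih =>
    rw [show i + (m + 1) + 2 = i + m + 2 + 1 by ring, sum_range_succ, ih,
      show i + (m + 1) + 1 = i + m + 1 + 1 by ring, sum_range_succ _ (i + m + 1),
      if_neg (by omega), if_neg (by omega)]
    ring

/-- Among the interior points of a partition there is one whose two adjacent steps are jointly
at most twice the average. -/
lemma exists_two_step_le (u : ℕ → ℝ) (hu : Monotone u) (N : ℕ) :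
    ∃ i ≤ N, u (i + 2) - u i ≤ 2 / ((N : ℝ) + 1) * (u (N + 2) - u 0) := by
  have hsum : ∑ i ∈ range (N + 1), (u (i + 2) - u i) ≤ 2 * (u (N + 2) - u 0) := by
    have h : ∑ i ∈ range (N + 1), (u (i + 2) - u i) =
        (u (N + 2) - u 1) + (u (N + 1) - u 0) := by
      rw [← sum_range_sub u (N + 1), ← sum_range_sub (fun j => u (j + 1)) (N + 1),
        ← sum_add_distrib]
      exact sum_congr rfl fun i _ => by ring
    have h1 := hu (show 0 ≤ 1 by omega)
    have h2 := hu (show N + 1 ≤ N + 2 by omega)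
    linarith
  by_contra! hcon
  have hlt : ∑ _i ∈ range (N + 1), 2 / ((N : ℝ) + 1) * (u (N + 2) - u 0) <
      ∑ i ∈ range (N + 1), (u (i + 2) - u i) :=
    sum_lt_sum_of_nonempty ⟨0, by simp⟩ fun i hi =>
      hcon i (Nat.lt_succ_iff.1 (mem_range.1 hi))
  rw [sum_const, card_range, nsmul_eq_mul] at hlt
  have hN : ((N : ℝ) + 1) ≠ 0 := by positivity
  have h : ((N + 1 : ℕ) : ℝ) * (2 / ((N : ℝ) + 1) * (u (N + 2) - u 0)) =
      2 * (u (N + 2) - u 0) := by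
    push_cast
    field_simp
  linarith

/-- Young's maximal inequality, with a finite zeta sum as constant. -/
lemma abs_sum_sub_le_sum {θ K : ℝ} (hθ : 0 ≤ θ) (hK : 0 ≤ K) {Ξ : ℝ → ℝ → ℝ}
    (hnear : ∀ s u t : ℝ, 0 ≤ s → s ≤ u → u ≤ t → t ≤ 1 →
      |Ξ s t - Ξ s u - Ξ u t| ≤ K * (t - s) ^ θ) (N : ℕ) :
    ∀ u : ℕ → ℝ, Monotone u → (∀ i, 0 ≤ u i) → (∀ i, u i ≤ 1) →
      |∑ j ∈ range (N + 1), Ξ (u j) (u (j + 1)) - Ξ (u 0) (u (N + 1))| ≤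
        2 ^ θ * (∑ k ∈ range N, 1 / ((k : ℝ) + 1) ^ θ) * K * (u (N + 1) - u 0) ^ θ := by
  induction N with
  | zero => intro u _ _ _; simp
  | succ N ih =>
    intro u hu h0 h1
    obtain ⟨i, hiN, hi⟩ := exists_two_step_le u hu N
    obtain ⟨m, rfl⟩ := Nat.exists_eq_add_of_le hiN
    have hskip := sum_range_skip Ξ u i m
    have hv := ih (fun j => if j ≤ i then u j else u (j + 1))
      (by
        intro a b hab
        dsimp only
        split_ifs <;> apply hu <;> omega)
      (by intro j; split_ifs <;> apply h0)
      (by intro j; split_ifs <;> apply h1)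
    rw [if_pos (Nat.zero_le i), if_neg (by omega : ¬ i + m + 1 ≤ i)] at hv
    have hd := hnear (u i) (u (i + 1)) (u (i + 2)) (h0 i) (hu (by omega)) (hu (by omega))
      (h1 _)
    have hT : 0 ≤ u (i + m + 2) - u 0 := sub_nonneg.2 (hu (by omega))
    have hpow : (u (i + 2) - u i) ^ θ ≤
        2 ^ θ * (1 / (((i + m : ℕ) : ℝ) + 1) ^ θ) * (u (i + m + 2) - u 0) ^ θ := by
      calc (u (i + 2) - u i) ^ θ
          ≤ (2 / (((i + m : ℕ) : ℝ) + 1) * (u (i + m + 2) - u 0)) ^ θ :=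
            Real.rpow_le_rpow (sub_nonneg.2 (hu (by omega))) hi hθ
        _ = _ := by
            rw [Real.mul_rpow (by positivity) hT, Real.div_rpow (by positivity) (by positivity)]
            ring
    have hpow' := mul_le_mul_of_nonneg_left hpow hK
    rw [sum_range_succ _ (i + m), show i + m + 1 + 1 = i + m + 2 by ring, hskip]
    rw [show i + m + 1 + 1 = i + m + 2 by ring] at hv
    rw [abs_le] at *
    constructor <;> linarith [hv.1, hv.2, hd.1, hd.2]

/-- Young's maximal inequality. -/
lemma abs_sum_sub_le {θ K : ℝ} (hθ : 1 < θ) (hK : 0 ≤ K) {Ξ : ℝ → ℝ → ℝ}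
    (hdiag : ∀ t : ℝ, 0 ≤ t → t ≤ 1 → Ξ t t = 0)
    (hnear : ∀ s u t : ℝ, 0 ≤ s → s ≤ u → u ≤ t → t ≤ 1 →
      |Ξ s t - Ξ s u - Ξ u t| ≤ K * (t - s) ^ θ) (N : ℕ)
    {u : ℕ → ℝ} (hu : Monotone u) (h0 : ∀ i, 0 ≤ u i) (h1 : ∀ i, u i ≤ 1) :
    |∑ j ∈ range N, Ξ (u j) (u (j + 1)) - Ξ (u 0) (u N)| ≤
      2 ^ θ * zetaSum θ * K * (u N - u 0) ^ θ := by
  have hT : 0 ≤ (u N - u 0) ^ θ := Real.rpow_nonneg (sub_nonneg.2 (hu (Nat.zero_le N))) θ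
  cases N with
  | zero =>
    have := zetaSum_nonneg θ
    simp only [range_zero, sum_empty, hdiag _ (h0 0) (h1 0), sub_zero, abs_zero]
    positivity
  | succ N =>
    refine (abs_sum_sub_le_sum (by linarith) hK hnear N u hu h0 h1).trans ?_
    have hz : ∑ k ∈ range N, 1 / ((k : ℝ) + 1) ^ θ ≤ zetaSum θ :=
      (summable_one_div_nat_add_one_rpow hθ).sum_le_tsum _ fun k _ => by positivity
    gcongr

/-- On a finite set of points, partition sums provide an additive function close to `Ξ`. -/
lemma exists_potential_on_finset {θ K : ℝ} (hθ : 1 < θ) (hK : 0 ≤ K) {Ξ : ℝ → ℝ → ℝ}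
    (hdiag : ∀ t : ℝ, 0 ≤ t → t ≤ 1 → Ξ t t = 0)
    (hnear : ∀ s u t : ℝ, 0 ≤ s → s ≤ u → u ≤ t → t ≤ 1 →
      |Ξ s t - Ξ s u - Ξ u t| ≤ K * (t - s) ^ θ) (F : Finset (Set.Icc (0 : ℝ) 1)) :
    ∃ φ : Set.Icc (0 : ℝ) 1 → ℝ, ∀ s ∈ F, ∀ t ∈ F, s ≤ t →
      |φ t - φ s - Ξ s t| ≤ 2 ^ θ * zetaSum θ * K * ((t : ℝ) - s) ^ θ := by
  rcases F.eq_empty_or_nonempty with rfl | hF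
  · exact ⟨0, by simp⟩
  have hc : 0 < #F := hF.card_pos
  let e := F.orderEmbOfFin rfl
  let u : ℕ → ℝ := fun j => (e ⟨min j (#F - 1), by omega⟩ : Set.Icc (0 : ℝ) 1)
  have hu : Monotone u := fun a b hab =>
    e.monotone (Fin.mk_le_mk.2 (min_le_min_right _ hab))
  have hidx : ∀ x : Set.Icc (0 : ℝ) 1, ∃ i, x ∈ F → i < #F ∧ e ⟨min i (#F - 1), by omega⟩ = x := by
    intro x
    by_cases hx : x ∈ F
    · obtain ⟨i, hi⟩ : x ∈ Set.range e := by simpa [e] using hx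
      refine ⟨i, fun _ => ⟨i.2, ?_⟩⟩
      rw [← hi]
      congr 1
      ext
      have := i.2
      simp only
      omega
    · exact ⟨0, fun h => absurd h hx⟩
  choose idx hidx using hidx
  refine ⟨fun x => ∑ j ∈ range (idx x), Ξ (u j) (u (j + 1)), fun s hs t ht hst => ?_⟩
  obtain ⟨his, hes⟩ := hidx s hs
  obtain ⟨hit, het⟩ := hidx t ht
  have hle : idx s ≤ idx t := by
    have h := hst
    rw [← hes, ← het, e.le_iff_le, Fin.mk_le_mk] at h
    omega
  obtain ⟨m, hm⟩ := Nat.exists_eq_add_of_le hle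
  have hus : u (idx s) = s := congrArg Subtype.val hes
  have hut : u (idx s + m) = t := hm ▸ congrArg Subtype.val het
  have h := abs_sum_sub_le hθ hK hdiag hnear m (u := fun j => u (idx s + j))
    (fun a b hab => hu (by omega)) (fun i => (e _).2.1) (fun i => (e _).2.2)
  simp only [add_zero, hus, hut] at h
  simpa only [hm, sum_range_add, add_sub_cancel_left, add_assoc] using h

/-- Existence of the sewing, by compactness along finer and finer finite sets. -/
lemma exists_additive_near {θ K : ℝ} (hθ : 1 < θ) (hK : 0 ≤ K) {Ξ : ℝ → ℝ → ℝ}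
    (hdiag : ∀ t : ℝ, 0 ≤ t → t ≤ 1 → Ξ t t = 0)
    (hnear : ∀ s u t : ℝ, 0 ≤ s → s ≤ u → u ≤ t → t ≤ 1 →
      |Ξ s t - Ξ s u - Ξ u t| ≤ K * (t - s) ^ θ) :
    ∃ I : ℝ → ℝ → ℝ,
      (∀ s u t : ℝ, 0 ≤ s → s ≤ u → u ≤ t → t ≤ 1 → I s t = I s u + I u t) ∧
      ∀ s t : ℝ, 0 ≤ s → s ≤ t → t ≤ 1 →
        |I s t - Ξ s t| ≤ 2 ^ θ * zetaSum θ * K * (t - s) ^ θ := by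
  choose φ hφ using exists_potential_on_finset hθ hK hdiag hnear
  let 𝒰 : Ultrafilter (Finset (Set.Icc (0 : ℝ) 1)) := Ultrafilter.of atTop
  have hev : ∀ s t : Set.Icc (0 : ℝ) 1, s ≤ t → ∀ᶠ F in (𝒰 : Filter _),
      φ F t - φ F s ∈ Metric.closedBall (Ξ s t) (2 ^ θ * zetaSum θ * K * ((t : ℝ) - s) ^ θ) := by
    intro s t hst
    have h : ∀ᶠ F : Finset (Set.Icc (0 : ℝ) 1) in (𝒰 : Filter _), {s, t} ⊆ F :=
      Ultrafilter.of_le atTop (eventually_ge_atTop ({s, t} : Finset _))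
    filter_upwards [h] with F hF
    rw [Metric.mem_closedBall, Real.dist_eq]
    exact hφ F s (hF (by simp)) t (hF (by simp)) hst
  have hlim : ∀ s t : ℝ, ∃ L : ℝ, ∀ (h0 : 0 ≤ s) (hst : s ≤ t) (h1 : t ≤ 1),
      |L - Ξ s t| ≤ 2 ^ θ * zetaSum θ * K * (t - s) ^ θ ∧
      Tendsto (fun F => φ F ⟨t, h0.trans hst, h1⟩ - φ F ⟨s, h0, hst.trans h1⟩) 𝒰 (𝓝 L) := by
    intro s t
    by_cases h : 0 ≤ s ∧ s ≤ t ∧ t ≤ 1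
    · obtain ⟨h0, hst, h1⟩ := h
      obtain ⟨L, hL, hL'⟩ := (isCompact_closedBall (Ξ s t)
        (2 ^ θ * zetaSum θ * K * (t - s) ^ θ)).ultrafilter_le_nhds'
        (𝒰.map fun F => φ F ⟨t, h0.trans hst, h1⟩ - φ F ⟨s, h0, hst.trans h1⟩)
        (hev ⟨s, h0, hst.trans h1⟩ ⟨t, h0.trans hst, h1⟩ hst)
      rw [Metric.mem_closedBall, Real.dist_eq] at hL
      exact ⟨L, fun _ _ _ => ⟨hL, hL'⟩⟩
    · exact ⟨0, fun h0 hst h1 => absurd ⟨h0, hst, h1⟩ h⟩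
  choose I hI using hlim
  refine ⟨I, fun s u t h0 hsu hut h1 => ?_, fun s t h0 hst h1 => (hI s t h0 hst h1).1⟩
  have h := (hI s u h0 hsu (hut.trans h1)).2.add (hI u t (h0.trans hsu) hut h1).2
  refine tendsto_nhds_unique (hI s t h0 (hsu.trans hut) h1).2 (h.congr fun F => ?_)
  ring

/-- An additive function that is `O((t - s) ^ θ)`-close to `Ξ`, with `θ > 1`, is the limit of the
partition sums of `Ξ`. -/
lemma tendsto_partition_sum {θ C : ℝ} (hθ : 1 < θ) (hC : 0 ≤ C) {Ξ J : ℝ → ℝ → ℝ}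
    (hadd : ∀ s u t : ℝ, 0 ≤ s → s ≤ u → u ≤ t → t ≤ 1 → J s t = J s u + J u t)
    (hclose : ∀ s t : ℝ, 0 ≤ s → s ≤ t → t ≤ 1 → |J s t - Ξ s t| ≤ C * (t - s) ^ θ)
    {s t : ℝ} (h0 : 0 ≤ s) (h1 : t ≤ 1) {N : ℕ → ℕ} {u : ℕ → ℕ → ℝ} {δ : ℕ → ℝ}
    (hus : ∀ n, u n 0 = s) (hut : ∀ n, u n (N n) = t)
    (hu : ∀ n i, i < N n → u n i < u n (i + 1))
    (hmesh : ∀ n i, i < N n → u n (i + 1) - u n i ≤ δ n) (hδ : Tendsto δ atTop (𝓝 0)) :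
    Tendsto (fun n => ∑ i ∈ range (N n), Ξ (u n i) (u n (i + 1))) atTop (𝓝 (J s t)) := by
  have hmono : ∀ n i j, i ≤ j → j ≤ N n → u n i ≤ u n j := by
    intro n i j hij
    induction j, hij using Nat.le_induction with
    | base => exact fun _ => le_rfl
    | succ j _ ih => exact fun hj => (ih (by omega)).trans (hu n j (by omega)).le
  have hsu : ∀ n i, i ≤ N n → s ≤ u n i := fun n i hi => hus n ▸ hmono n 0 i i.zero_le hi
  have hut' : ∀ n i, i ≤ N n → u n i ≤ t := fun n i hi =>
    (hmono n i (N n) hi le_rfl).trans_eq (hut n)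
  have htele : ∀ n, ∑ i ∈ range (N n), J (u n i) (u n (i + 1)) = J s t := by
    intro n
    have h : ∀ m ≤ N n, ∑ i ∈ range m, J (u n i) (u n (i + 1)) = J s (u n m) := by
      intro m
      induction m with
      | zero =>
        intro _
        have hs1 : s ≤ 1 := (hsu n 0 (Nat.zero_le _)).trans ((hut' n 0 (Nat.zero_le _)).trans h1)
        have := hadd s s s h0 le_rfl le_rfl hs1
        rw [range_zero, sum_empty, hus]
        linarith
      | succ m ih =>
        intro hm
        rw [sum_range_succ, ih (by omega), ← hadd s (u n m) (u n (m + 1)) h0 (hsu n m (by omega))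
          (hu n m hm).le ((hut' n _ hm).trans h1)]
    rw [h _ le_rfl, hut]
  have hbound : ∀ n, ‖∑ i ∈ range (N n), Ξ (u n i) (u n (i + 1)) - J s t‖ ≤
      C * δ n ^ (θ - 1) * (t - s) := by
    intro n
    rw [← htele n, ← sum_sub_distrib]
    have hts : t - s = ∑ i ∈ range (N n), (u n (i + 1) - u n i) := by
      rw [sum_range_sub, hut, hus]
    rw [hts, mul_sum]
    refine norm_sum_le_of_le _ fun i hi => ?_
    have hi := mem_range.1 hi
    have hpos : 0 < u n (i + 1) - u n i := sub_pos.2 (hu n i hi)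
    rw [Real.norm_eq_abs, abs_sub_comm]
    refine (hclose _ _ (h0.trans (hsu n i hi.le)) (hu n i hi).le
      ((hut' n _ hi).trans h1)).trans ?_
    rw [mul_assoc]
    refine mul_le_mul_of_nonneg_left ?_ hC
    calc (u n (i + 1) - u n i) ^ θ
        = (u n (i + 1) - u n i) ^ (θ - 1) * (u n (i + 1) - u n i) := by
          rw [← Real.rpow_add_one hpos.ne', sub_add_cancel]
      _ ≤ δ n ^ (θ - 1) * (u n (i + 1) - u n i) :=
          mul_le_mul_of_nonneg_right
            (Real.rpow_le_rpow hpos.le (hmesh n i hi) (by linarith)) hpos.le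
  have hlim : Tendsto (fun n => C * δ n ^ (θ - 1) * (t - s)) atTop (𝓝 0) := by
    have h := hδ.rpow_const (p := θ - 1) (Or.inr (by linarith))
    rw [Real.zero_rpow (by linarith)] at h
    simpa using (h.const_mul C).mul_const (t - s)
  exact tendsto_sub_nhds_zero_iff.1 (squeeze_zero_norm hbound hlim)

lemma additive_near_unique {θ C : ℝ} (hθ : 1 < θ) (hC : 0 ≤ C) {Ξ I J : ℝ → ℝ → ℝ}
    (hI : ∀ s u t : ℝ, 0 ≤ s → s ≤ u → u ≤ t → t ≤ 1 → I s t = I s u + I u t)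
    (hIc : ∀ s t : ℝ, 0 ≤ s → s ≤ t → t ≤ 1 → |I s t - Ξ s t| ≤ C * (t - s) ^ θ)
    (hJ : ∀ s u t : ℝ, 0 ≤ s → s ≤ u → u ≤ t → t ≤ 1 → J s t = J s u + J u t)
    (hJc : ∀ s t : ℝ, 0 ≤ s → s ≤ t → t ≤ 1 → |J s t - Ξ s t| ≤ C * (t - s) ^ θ)
    {s t : ℝ} (h0 : 0 ≤ s) (hst : s ≤ t) (h1 : t ≤ 1) : I s t = J s t := by
  rcases hst.eq_or_lt with rfl | hlt
  · have := hI s s s h0 le_rfl le_rfl h1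
    have := hJ s s s h0 le_rfl le_rfl h1
    linarith
  let u : ℕ → ℕ → ℝ := fun n i => s + i * ((t - s) / ((n : ℝ) + 1))
  have hstep : ∀ n i, u n (i + 1) - u n i = (t - s) / ((n : ℝ) + 1) := fun n i => by
    simp only [u]; push_cast; ring
  have hu0 : ∀ n, u n 0 = s := fun n => by simp [u]
  have hu1 : ∀ n, u n (n + 1) = t := fun n => by
    have : (n : ℝ) + 1 ≠ 0 := by positivity
    simp only [u]; push_cast; field_simp; ring
  have hu : ∀ n i, i < n + 1 → u n i < u n (i + 1) := fun n i _ => by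
    have : 0 < (t - s) / ((n : ℝ) + 1) := div_pos (sub_pos.2 hlt) (by positivity)
    linarith [hstep n i]
  have hδ : Tendsto (fun n : ℕ => (t - s) / ((n : ℝ) + 1)) atTop (𝓝 0) := by
    simpa [div_eq_mul_inv] using
      (tendsto_one_div_add_atTop_nhds_zero_nat (𝕜 := ℝ)).const_mul (t - s)
  exact tendsto_nhds_unique
    (tendsto_partition_sum hθ hC hI hIc h0 h1 hu0 hu1 hu
      (fun n i _ => (hstep n i).le) hδ)
    (tendsto_partition_sum hθ hC hJ hJc h0 h1 hu0 hu1 hu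
      (fun n i _ => (hstep n i).le) hδ)

/-- additive sewing lemma: if `Ξ(t,t) = 0` and
`|Ξ(s,t) − Ξ(s,u) − Ξ(u,t)| ≤ K (t−s)^θ` with `θ > 1`, then there is a unique additive
function `I` on pairs `0 ≤ s ≤ t ≤ 1` with `|I(s,t) − Ξ(s,t)| ≤ 2^θ ζ(θ) K (t−s)^θ`;
moreover the partition sums `Ξ(Δ_n)` converge to `I(s,t)` along any sequence of partitions
of `[s,t]` with mesh tending to `0`. -/
theorem additive_sewing_lemma (θ K : ℝ) (hθ : 1 < θ) (hK : 0 ≤ K)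
    (Ξ : ℝ → ℝ → ℝ)
    (hdiag : ∀ t : ℝ, 0 ≤ t → t ≤ 1 → Ξ t t = 0)
    (hnear : ∀ s u t : ℝ, 0 ≤ s → s ≤ u → u ≤ t → t ≤ 1 →
      |Ξ s t - Ξ s u - Ξ u t| ≤ K * (t - s) ^ θ) :
    ∃ I : ℝ → ℝ → ℝ,
      -- (i) additivity
      (∀ s u t : ℝ, 0 ≤ s → s ≤ u → u ≤ t → t ≤ 1 → I s t = I s u + I u t) ∧
      -- (ii) closeness to Ξ
      (∀ s t : ℝ, 0 ≤ s → s ≤ t → t ≤ 1 →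
        |I s t - Ξ s t| ≤ 2 ^ θ * zetaSum θ * K * (t - s) ^ θ) ∧
      -- uniqueness among functions satisfying (i) and (ii)
      (∀ I' : ℝ → ℝ → ℝ,
        (∀ s u t : ℝ, 0 ≤ s → s ≤ u → u ≤ t → t ≤ 1 → I' s t = I' s u + I' u t) →
        (∀ s t : ℝ, 0 ≤ s → s ≤ t → t ≤ 1 →
          |I' s t - Ξ s t| ≤ 2 ^ θ * zetaSum θ * K * (t - s) ^ θ) →
        ∀ s t : ℝ, 0 ≤ s → s ≤ t → t ≤ 1 → I' s t = I s t) ∧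
      -- convergence of partition sums along any sequence of partitions with mesh → 0
      (∀ s t : ℝ, 0 ≤ s → s ≤ t → t ≤ 1 →
        ∀ (N : ℕ → ℕ) (u : ℕ → ℕ → ℝ) (δ : ℕ → ℝ),
          (∀ n, 1 ≤ N n) →
          (∀ n, u n 0 = s) → (∀ n, u n (N n) = t) →
          (∀ n i, i < N n → u n i < u n (i + 1)) →
          (∀ n i, i < N n → u n (i + 1) - u n i ≤ δ n) →
          Filter.Tendsto δ Filter.atTop (nhds 0) →
          Filter.Tendsto (fun n => ∑ i ∈ Finset.range (N n), Ξ (u n i) (u n (i + 1)))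
            Filter.atTop (nhds (I s t))) := by
  have hC : 0 ≤ 2 ^ θ * zetaSum θ * K := by
    have := zetaSum_nonneg θ
    positivity
  obtain ⟨I, hadd, hclose⟩ := exists_additive_near hθ hK hdiag hnear
  refine ⟨I, hadd, hclose, fun I' hadd' hclose' s t h0 hst h1 => ?_, ?_⟩
  · exact additive_near_unique hθ hC hadd' hclose' hadd hclose h0 hst h1
  · intro s t h0 _ h1 N u δ _ hus hut hu hmesh hδ
    exact tendsto_partition_sum hθ hC hadd hclose h0 h1 hus hut hu hmesh hδ
end
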